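/- The degree-3 dilation of the square lattice ℤ² equals 1+√2: the infimum, over all plane geometric graphs G on ℤ² of maximum degree at most 3, of the dilation of G is equal to 1+√2, and this infimum is attained. -/

import Mathlib

open SimpleGraph ENNReal

/-- The point of the Euclidean plane (identified with `ℂ`) corresponding to a lattice point. -/
noncomputable def toC (p : ℤ × ℤ) : ℂ := ⟨(p.1 : ℝ), (p.2 : ℝ)⟩

/-- The Euclidean length of a walk in a geometric graph on `ℤ²`:
the sum of the Euclidean lengths of its edges. -/
noncomputable def walkLen (G : SimpleGraph (ℤ × ℤ)) :
    ∀ {p q : ℤ × ℤ}, G.Walk p q → ℝ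
  | _, _, .nil => 0
  | p, _, .cons (v := v) _ w => dist (toC p) (toC v) + walkLen G w

/-- The graph distance `d_G(p,q)`: infimum of Euclidean lengths of walks from `p` to `q`
(`∞` if there is no walk). -/
noncomputable def gdist (G : SimpleGraph (ℤ × ℤ)) (p q : ℤ × ℤ) : ℝ≥0∞ :=
  ⨅ w : G.Walk p q, ENNReal.ofReal (walkLen G w)

/-- `G` has maximum degree at most `3`. -/
def MaxDegThree (G : SimpleGraph (ℤ × ℤ)) : Prop :=
  ∀ v : ℤ × ℤ, (G.neighborSet v).encard ≤ 3

/-- `G` is plane: two distinct edges, viewed as closed segments in the plane,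
intersect at most in a common endpoint. -/
def IsPlane (G : SimpleGraph (ℤ × ℤ)) : Prop :=
  ∀ a b c d : ℤ × ℤ, G.Adj a b → G.Adj c d → s(a, b) ≠ s(c, d) →
    ∀ x : ℂ, x ∈ segment ℝ (toC a) (toC b) → x ∈ segment ℝ (toC c) (toC d) →
      x ∈ ({toC a, toC b} : Set ℂ) ∧ x ∈ ({toC c, toC d} : Set ℂ)

/-- `G` is locally optimal. -/
def LocallyOptimal (G : SimpleGraph (ℤ × ℤ)) : Prop :=
  IsPlane G ∧ MaxDegThree G ∧
    ∀ p q : ℤ × ℤ, dist (toC p) (toC q) ≤ Real.sqrt 5 →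
      gdist G p q ≤ ENNReal.ofReal ((1 + Real.sqrt 2) * dist (toC p) (toC q))

/-- The dilation of `G`. -/
noncomputable def dil (G : SimpleGraph (ℤ × ℤ)) : ℝ≥0∞ :=
  ⨆ (p : ℤ × ℤ) (q : ℤ × ℤ) (_ : p ≠ q),
    gdist G p q / ENNReal.ofReal (dist (toC p) (toC q))

/-! ### Lengths of walks -/

/-- The squared Euclidean norm of a lattice vector. -/
def sqNorm (v : ℤ × ℤ) : ℤ := v.1 ^ 2 + v.2 ^ 2

lemma sqNorm_neg (v : ℤ × ℤ) : sqNorm (-v) = sqNorm v := by simp [sqNorm]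

lemma sqNorm_nonneg (v : ℤ × ℤ) : 0 ≤ sqNorm v := by unfold sqNorm; positivity

lemma sqNorm_pos {v : ℤ × ℤ} (hv : v ≠ 0) : 0 < sqNorm v := by
  refine lt_of_le_of_ne (sqNorm_nonneg v) fun h => hv ?_
  unfold sqNorm at h
  ext
  · simp only [Prod.fst_zero]; nlinarith [sq_nonneg v.1, sq_nonneg v.2]
  · simp only [Prod.snd_zero]; nlinarith [sq_nonneg v.1, sq_nonneg v.2]

lemma dist_toC (p q : ℤ × ℤ) : dist (toC p) (toC q) = √(sqNorm (q - p) : ℝ) := by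
  rw [Complex.dist_eq_re_im]
  congr 1
  simp [toC, sqNorm]
  ring

section Walks

variable {G : SimpleGraph (ℤ × ℤ)} {p q r : ℤ × ℤ} {k l : ℝ}

lemma walkLen_nonneg (w : G.Walk p q) : 0 ≤ walkLen G w := by
  induction w with
  | nil => simp [walkLen]
  | cons h w ih => simp only [walkLen]; positivity

lemma dist_le_walkLen (w : G.Walk p q) : dist (toC p) (toC q) ≤ walkLen G w := by
  induction w with
  | nil => simp [walkLen]
  | cons h w ih => exact (dist_triangle _ _ _).trans (by simp only [walkLen]; gcongr)

lemma walkLen_append (w : G.Walk p q) (w' : G.Walk q r) :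
    walkLen G (w.append w') = walkLen G w + walkLen G w' := by
  induction w with
  | nil => simp [walkLen]
  | cons h w ih => simp [walkLen, ih, add_assoc]

lemma walkLen_reverse (w : G.Walk p q) : walkLen G w.reverse = walkLen G w := by
  induction w with
  | nil => simp [walkLen]
  | cons h w ih => simp [walkLen, walkLen_append, ih, _root_.dist_comm, add_comm]

/-- There is a walk from `p` to `q` of length at most `l`. -/
def Joins (G : SimpleGraph (ℤ × ℤ)) (p q : ℤ × ℤ) (l : ℝ) : Prop :=
  ∃ w : G.Walk p q, walkLen G w ≤ l

lemma Joins.mono (h : Joins G p q k) (hkl : k ≤ l) : Joins G p q l :=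
  h.imp fun _ hw => hw.trans hkl

lemma Joins.trans (h : Joins G p q k) (h' : Joins G q r l) : Joins G p r (k + l) := by
  obtain ⟨w, hw⟩ := h
  obtain ⟨w', hw'⟩ := h'
  exact ⟨w.append w', by rw [walkLen_append]; gcongr⟩

lemma Joins.symm (h : Joins G p q l) : Joins G q p l :=
  let ⟨w, hw⟩ := h
  ⟨w.reverse, by rwa [walkLen_reverse]⟩

lemma joins_refl (p : ℤ × ℤ) : Joins G p p 0 := ⟨.nil, by simp [walkLen]⟩

lemma joins_of_adj (h : G.Adj p q) : Joins G p q (√(sqNorm (q - p) : ℝ)) :=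
  ⟨.cons h .nil, by simp [walkLen, dist_toC]⟩

lemma Joins.gdist_le (h : Joins G p q l) : gdist G p q ≤ ENNReal.ofReal l :=
  let ⟨w, hw⟩ := h
  (iInf_le _ w).trans (ENNReal.ofReal_le_ofReal hw)

/-! ### The lower bound -/

lemma one_add_sqrt_two_le_of_unit {v e : ℤ × ℤ} (he : sqNorm e = 1) (hv : v ≠ 0) (hve : v ≠ e) :
    1 + √2 ≤ √(sqNorm v : ℝ) + √(sqNorm (e - v) : ℝ) := by
  have h1 : 1 ≤ sqNorm v := sqNorm_pos hv
  have h2 : 1 ≤ sqNorm (e - v) := sqNorm_pos (sub_ne_zero.2 hve.symm)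
  have h3 : sqNorm v ≠ sqNorm (e - v) := by
    intro h
    simp only [sqNorm, Prod.fst_sub, Prod.snd_sub] at h he
    have : 2 * (e.1 * v.1 + e.2 * v.2) = 1 := by linarith
    omega
  have key : ∀ m n : ℤ, 1 ≤ m → 2 ≤ n → 1 + √2 ≤ √(m : ℝ) + √(n : ℝ) := fun m n hm hn =>
    add_le_add (Real.one_le_sqrt.2 (by exact_mod_cast hm))
      (Real.sqrt_le_sqrt (by exact_mod_cast hn))
  by_cases h : 2 ≤ sqNorm v
  · rw [add_comm (√(sqNorm v : ℝ))]
    exact key _ _ h2 h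
  · exact key _ _ h1 (by omega)

lemma le_gdist_of_not_adj {e : ℤ × ℤ} (he : sqNorm e = 1) (h : ¬G.Adj 0 e) :
    ENNReal.ofReal (1 + √2) ≤ gdist G 0 e := by
  refine le_iInf fun w => ENNReal.ofReal_le_ofReal ?_
  cases w with
  | nil => simp [sqNorm] at he
  | @cons _ v _ hv w =>
    have hve : v ≠ e := by rintro rfl; exact h hv
    have := one_add_sqrt_two_le_of_unit he hv.ne' hve
    have hw := dist_le_walkLen w
    simp only [walkLen]
    rw [dist_toC] at hw ⊢
    rw [sub_zero]
    linarith

lemma exists_unit_not_adj (hG : MaxDegThree G) : ∃ e, sqNorm e = 1 ∧ ¬G.Adj 0 e := by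
  by_contra! h
  let s : Finset (ℤ × ℤ) := {(1, 0), (-1, 0), (0, 1), (0, -1)}
  have hs : (s : Set (ℤ × ℤ)) ⊆ G.neighborSet 0 := by
    intro e he
    refine h e ?_
    have : ∀ e ∈ s, sqNorm e = 1 := by decide
    exact this e he
  have := (Set.encard_le_encard hs).trans (hG 0)
  rw [Set.encard_coe_eq_coe_finsetCard] at this
  have hc : s.card = 4 := by decide
  rw [hc] at this
  exact absurd this (by decide)

lemma MaxDegThree.le_dil (hG : MaxDegThree G) : ENNReal.ofReal (1 + √2) ≤ dil G := by
  obtain ⟨e, he, hadj⟩ := exists_unit_not_adj hG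
  have h0 : (0 : ℤ × ℤ) ≠ e := by rintro rfl; simp [sqNorm] at he
  refine (le_gdist_of_not_adj he hadj).trans ?_
  refine le_trans ?_ (le_iSup_of_le (0 : ℤ × ℤ) (le_iSup_of_le e (le_iSup_of_le h0 le_rfl)))
  simp [dist_toC, he]

lemma dil_le_of_joins {C : ℝ} (hC : 0 ≤ C)
    (h : ∀ p v : ℤ × ℤ, v ≠ 0 → Joins G p (p + v) (C * √(sqNorm v : ℝ))) :
    dil G ≤ ENNReal.ofReal C := by
  refine iSup_le fun p => iSup_le fun q => iSup_le fun hpq => ?_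
  refine ENNReal.div_le_of_le_mul ?_
  rw [← ENNReal.ofReal_mul hC, dist_toC]
  have := h p (q - p) (sub_ne_zero.2 hpq.symm)
  rw [add_sub_cancel] at this
  exact this.gdist_le

end Walks

/-! ### The optimal graph -/

/-- The class of a lattice point modulo the period lattice spanned by `(8, 0)` and `(2, 1)`. -/
def periodClass (p : ℤ × ℤ) : ℕ := ((p.1 - 2 * p.2) % 8).toNat

/-- The class reached from class `c` by the displacement `s`. -/
def shiftClass (c : ℕ) (s : ℤ × ℤ) : ℕ := ((c + s.1 - 2 * s.2) % 8).toNat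

/-- The three edges, as displacements, leaving a lattice point of class `c`. -/
def edgeSteps (c : ℕ) : List (ℤ × ℤ) :=
  [[(0, 1), (0, -1), (-1, 1)], [(1, -1), (0, -1), (-1, 1)], [(1, 0), (0, 1), (0, -1)],
    [(-1, 0), (0, 1), (0, -1)], [(-1, 1), (0, 1), (1, -1)], [(0, 1), (1, -1), (0, -1)],
    [(0, -1), (1, 0), (1, -1)], [(-1, 1), (-1, 0), (0, 1)]].getD c []

lemma periodClass_lt (p : ℤ × ℤ) : periodClass p < 8 := by unfold periodClass; omega

lemma periodClass_add (p s : ℤ × ℤ) : periodClass (p + s) = shiftClass (periodClass p) s := by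
  simp only [periodClass, shiftClass, Prod.fst_add, Prod.snd_add]
  omega

lemma neg_mem_edgeSteps : ∀ c < 8, ∀ s ∈ edgeSteps c, -s ∈ edgeSteps (shiftClass c s) := by
  decide

lemma mem_directions_of_mem_edgeSteps : ∀ c < 8, ∀ s ∈ edgeSteps c,
    s ∈ [((1, 0) : ℤ × ℤ), (0, 1), (1, -1)] ∨ -s ∈ [((1, 0) : ℤ × ℤ), (0, 1), (1, -1)] := by
  decide

/-- A cubic plane graph on `ℤ²` of dilation `1 + √2`. -/
def octoGraph : SimpleGraph (ℤ × ℤ) where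
  Adj p q := q - p ∈ edgeSteps (periodClass p)
  symm := ⟨fun p q h => by
    have := neg_mem_edgeSteps _ (periodClass_lt p) _ h
    rwa [← periodClass_add, neg_sub, add_sub_cancel] at this⟩
  loopless := ⟨fun p h => by
    rw [sub_self] at h
    have : ∀ c < 8, (0 : ℤ × ℤ) ∉ edgeSteps c := by decide
    exact this _ (periodClass_lt p) h⟩

lemma maxDegThree_octoGraph : MaxDegThree octoGraph := by
  intro p
  have hsub : octoGraph.neighborSet p ⊆
      ((edgeSteps (periodClass p)).toFinset.image (p + ·) : Finset (ℤ × ℤ)) := by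
    intro q hq
    rw [Finset.coe_image]
    exact ⟨q - p, List.mem_toFinset.2 hq, add_sub_cancel p q⟩
  refine (Set.encard_le_encard hsub).trans ?_
  rw [Set.encard_coe_eq_coe_finsetCard]
  have hlen : ∀ c < 8, (edgeSteps c).length ≤ 3 := by decide
  exact_mod_cast Finset.card_image_le.trans
    ((List.toFinset_card_le _).trans (hlen _ (periodClass_lt p)))

/-! ### Planarity -/

/-- Two edges of the triangular lattice meet only in common endpoints. -/
lemma triangular_edges_meet {a d c f : ℤ × ℤ} {s t : ℝ}
    (hd : d ∈ [((1, 0) : ℤ × ℤ), (0, 1), (1, -1)]) (hf : f ∈ [((1, 0) : ℤ × ℤ), (0, 1), (1, -1)])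
    (hs : s ∈ Set.Icc (0 : ℝ) 1) (ht : t ∈ Set.Icc (0 : ℝ) 1)
    (h1 : (a.1 : ℝ) + s * d.1 = c.1 + t * f.1) (h2 : (a.2 : ℝ) + s * d.2 = c.2 + t * f.2) :
    (a = c ∧ d = f) ∨ ((s = 0 ∨ s = 1) ∧ (t = 0 ∨ t = 1)) := by
  have unit_int : ∀ {u : ℝ} (n : ℤ), u ∈ Set.Icc (0 : ℝ) 1 → u = n → u = 0 ∨ u = 1 := by
    rintro u n ⟨h0, h1⟩ rfl
    have h0' : 0 ≤ n := by exact_mod_cast h0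
    have h1' : n ≤ 1 := by exact_mod_cast h1
    interval_cases n <;> simp
  have sub_int : ∀ n : ℤ, s - t = n → n = 0 ∨ ((s = 0 ∨ s = 1) ∧ (t = 0 ∨ t = 1)) := by
    intro n hn
    obtain ⟨hs0, hs1⟩ := hs
    obtain ⟨ht0, ht1⟩ := ht
    have h0 : -1 ≤ n := by exact_mod_cast (by linarith : (-1 : ℝ) ≤ n)
    have h1 : n ≤ 1 := by exact_mod_cast (by linarith : (n : ℝ) ≤ 1)
    interval_cases n
    · push_cast at hn
      exact .inr ⟨.inl (by linarith), .inr (by linarith)⟩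
    · exact .inl rfl
    · push_cast at hn
      exact .inr ⟨.inr (by linarith), .inl (by linarith)⟩
  obtain ⟨a1, a2⟩ := a
  obtain ⟨c1, c2⟩ := c
  simp only [List.mem_cons, List.not_mem_nil, or_false] at hd hf
  rcases hd with rfl | rfl | rfl <;> rcases hf with rfl | rfl | rfl <;>
    push_cast at h1 h2 <;> ring_nf at h1 h2
  · have e : a2 = c2 := by exact_mod_cast h2
    rcases sub_int (c1 - a1) (by push_cast; linarith) with h | h
    · exact .inl ⟨Prod.ext (by simp only; omega) e, rfl⟩
    · exact .inr h
  · exact .inr ⟨unit_int (c1 - a1) hs (by push_cast; linarith),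
      unit_int (a2 - c2) ht (by push_cast; linarith)⟩
  · exact .inr ⟨unit_int (c1 - a1 + c2 - a2) hs (by push_cast; linarith),
      unit_int (c2 - a2) ht (by push_cast; linarith)⟩
  · exact .inr ⟨unit_int (c2 - a2) hs (by push_cast; linarith),
      unit_int (a1 - c1) ht (by push_cast; linarith)⟩
  · have e : a1 = c1 := by exact_mod_cast h1
    rcases sub_int (c2 - a2) (by push_cast; linarith) with h | h
    · exact .inl ⟨Prod.ext e (by simp only; omega), rfl⟩
    · exact .inr h
  · exact .inr ⟨unit_int (c1 - a1 + c2 - a2) hs (by push_cast; linarith),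
      unit_int (a1 - c1) ht (by push_cast; linarith)⟩
  · exact .inr ⟨unit_int (a2 - c2) hs (by push_cast; linarith),
      unit_int (a1 - c1 + a2 - c2) ht (by push_cast; linarith)⟩
  · exact .inr ⟨unit_int (c1 - a1) hs (by push_cast; linarith),
      unit_int (a1 - c1 + a2 - c2) ht (by push_cast; linarith)⟩
  · have e : a1 + a2 = c1 + c2 := by exact_mod_cast (by linarith : (a1 : ℝ) + a2 = c1 + c2)
    rcases sub_int (c1 - a1) (by push_cast; linarith) with h | h
    · exact .inl ⟨Prod.ext (by simp only; omega) (by simp only; omega), rfl⟩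
    · exact .inr h

lemma octoGraph_adj_oriented {a b : ℤ × ℤ} (h : octoGraph.Adj a b) :
    ∃ c d : ℤ × ℤ, d ∈ [((1, 0) : ℤ × ℤ), (0, 1), (1, -1)] ∧
      ((a = c ∧ b = c + d) ∨ (b = c ∧ a = c + d)) := by
  rcases mem_directions_of_mem_edgeSteps _ (periodClass_lt a) _ h with h | h
  · exact ⟨a, b - a, h, .inl ⟨rfl, (add_sub_cancel a b).symm⟩⟩
  · exact ⟨b, -(b - a), h, .inr ⟨rfl, by abel⟩⟩

lemma exists_of_mem_segment_toC {c d : ℤ × ℤ} {x : ℂ}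
    (hx : x ∈ segment ℝ (toC c) (toC (c + d))) :
    ∃ t ∈ Set.Icc (0 : ℝ) 1, x.re = c.1 + t * d.1 ∧ x.im = c.2 + t * d.2 ∧
      (t = 0 ∨ t = 1 → x ∈ ({toC c, toC (c + d)} : Set ℂ)) := by
  rw [segment_eq_image'] at hx
  obtain ⟨t, ht, rfl⟩ := hx
  refine ⟨t, ht, by simp [toC], by simp [toC], ?_⟩
  rintro (rfl | rfl) <;> simp

lemma isPlane_octoGraph : IsPlane octoGraph := by
  have key : ∀ a d c f : ℤ × ℤ, d ∈ [((1, 0) : ℤ × ℤ), (0, 1), (1, -1)] →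
      f ∈ [((1, 0) : ℤ × ℤ), (0, 1), (1, -1)] → s(a, a + d) ≠ s(c, c + f) →
      ∀ x : ℂ, x ∈ segment ℝ (toC a) (toC (a + d)) → x ∈ segment ℝ (toC c) (toC (c + f)) →
        x ∈ ({toC a, toC (a + d)} : Set ℂ) ∧ x ∈ ({toC c, toC (c + f)} : Set ℂ) := by
    intro a d c f hd hf hne x hx hx'
    obtain ⟨s, hs, hs1, hs2, hs3⟩ := exists_of_mem_segment_toC hx
    obtain ⟨t, ht, ht1, ht2, ht3⟩ := exists_of_mem_segment_toC hx'
    rcases triangular_edges_meet hd hf hs ht (hs1.symm.trans ht1) (hs2.symm.trans ht2) with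
      ⟨rfl, rfl⟩ | ⟨h, h'⟩
    · exact absurd rfl hne
    · exact ⟨hs3 h, ht3 h'⟩
  intro a b c d hab hcd hne x hx hx'
  obtain ⟨a', e, he, h⟩ := octoGraph_adj_oriented hab
  obtain ⟨c', f, hf, h'⟩ := octoGraph_adj_oriented hcd
  have := key a' e c' f he hf
  rcases h with ⟨rfl, rfl⟩ | ⟨rfl, rfl⟩ <;> rcases h' with ⟨rfl, rfl⟩ | ⟨rfl, rfl⟩
  · exact this hne x hx hx'
  · rw [Set.pair_comm (toC _) (toC d)]
    exact this (by rwa [Sym2.eq_swap (a := d)]) x hx (by rwa [segment_symm])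
  · rw [Set.pair_comm (toC _) (toC b)]
    exact this (by rwa [Sym2.eq_swap (a := b)]) x (by rwa [segment_symm]) hx'
  · rw [Set.pair_comm (toC _) (toC b), Set.pair_comm (toC _) (toC d)]
    exact this (by rwa [Sym2.eq_swap (a := b), Sym2.eq_swap (a := d)]) x
      (by rwa [segment_symm]) (by rwa [segment_symm])

/-! ### Short displacements -/

/-- Search for a walk from a point of class `c` with displacement `v`, using at most `a` unit edges
and `b` diagonal edges; the first argument bounds the depth of the search. -/
def reach : ℕ → ℕ → ℕ → ℕ → ℤ × ℤ → Bool
  | 0, _, _, _, v => decide (v = 0)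
  | n + 1, a, b, c, v => decide (v = 0) || (decide (v.1.natAbs ≤ a + b) &&
      (edgeSteps c).any fun s =>
        if s.1 * s.2 = 0 then decide (0 < a) && reach n (a - 1) b (shiftClass c s) (v - s)
        else decide (0 < b) && reach n a (b - 1) (shiftClass c s) (v - s))

lemma sqNorm_edgeStep : ∀ c < 8, ∀ s ∈ edgeSteps c,
    if s.1 * s.2 = 0 then sqNorm s = 1 else sqNorm s = 2 := by
  decide

lemma joins_of_reach {n a b : ℕ} {v : ℤ × ℤ} {p : ℤ × ℤ}
    (h : reach n a b (periodClass p) v = true) : Joins octoGraph p (p + v) (a + b * √2) := by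
  have nil : ∀ (a b : ℕ) (p : ℤ × ℤ), Joins octoGraph p (p + 0) (a + b * √2) := fun a b p => by
    rw [add_zero]
    exact (joins_refl p).mono (by positivity)
  induction n generalizing a b v p with
  | zero =>
    obtain rfl : v = 0 := by simpa [reach] using h
    exact nil a b p
  | succ n ih =>
    rw [reach, Bool.or_eq_true, Bool.and_eq_true, List.any_eq_true] at h
    rcases h with h | ⟨-, s, hs, h⟩
    · obtain rfl : v = 0 := by simpa using h
      exact nil a b p
    · have hadj : octoGraph.Adj p (p + s) := by
        change p + s - p ∈ _
        rwa [add_sub_cancel_left]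
      have hlen := sqNorm_edgeStep _ (periodClass_lt p) _ hs
      have hstep := joins_of_adj hadj
      rw [add_sub_cancel_left] at hstep
      rw [← periodClass_add] at h
      split_ifs at h hlen with hu <;>
        rw [Bool.and_eq_true, decide_eq_true_iff] at h <;>
        rw [hlen] at hstep <;>
        have hrest := ih h.2 <;>
        rw [add_assoc, add_sub_cancel] at hrest <;>
        refine (hstep.trans hrest).mono (le_of_eq ?_)
      · push_cast [Nat.cast_sub (show 1 ≤ a from h.1)]
        rw [Real.sqrt_one]
        ring
      · push_cast [Nat.cast_sub (show 1 ≤ b from h.1)]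
        ring

/-- Displacements `v` with numbers `(a, b)` of unit and diagonal edges
such that every `p` is joined to `p + v` by a walk respecting one of these bounds. -/
def shortDisplacements : List ((ℤ × ℤ) × List (ℕ × ℕ)) :=
  [((1, 0), [(1, 1)]), ((2, 0), [(2, 2)]), ((3, 0), [(3, 3)]), ((4, 0), [(4, 3)]),
    ((-4, 1), [(3, 4)]), ((-3, 1), [(2, 3)]), ((-2, 1), [(1, 2), (3, 1)]), ((-1, 1), [(2, 1)]),
    ((0, 1), [(1, 1)]), ((1, 1), [(2, 1)]), ((-3, 2), [(3, 3), (5, 2)]),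
    ((-2, 2), [(2, 2), (4, 1)]), ((-1, 2), [(1, 2), (3, 0)]), ((0, 2), [(2, 1)]),
    ((1, 2), [(3, 1)]), ((2, 2), [(4, 1)]), ((-1, 3), [(2, 3)]), ((0, 3), [(3, 1)]),
    ((1, 3), [(4, 2)]), ((2, 3), [(5, 1)])]

/-- Periods `e` of the graph, each with a rational number `n / m` such that `p` and `p + e` are
joined by a walk of length at most `(1 + √2) * (n / m)`, and with bounds as in
`shortDisplacements`. -/
def shortPeriods : List ((ℤ × ℤ) × (ℤ × ℤ) × List (ℕ × ℕ)) :=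
  [((2, 1), (11, 6), [(3, 1)]), ((-2, 3), (11, 5), [(3, 1), (1, 3)]), ((0, 4), (9, 4), [(4, 1)]),
    ((4, -2), (24, 7), [(4, 3), (2, 4)])]

lemma reach_shortDisplacements : ∀ x ∈ shortDisplacements, ∀ c < 8,
    ∃ k ∈ x.2, reach (k.1 + k.2) k.1 k.2 c x.1 = true := by
  decide +kernel

lemma reach_shortPeriods : ∀ x ∈ shortPeriods, ∀ c < 8,
    ∃ k ∈ x.2.2, reach (k.1 + k.2) k.1 k.2 c x.1 = true := by
  decide +kernel

lemma add_mul_sqrt_two_nonpos {p q : ℤ} (h1 : 10000 * p + 14142 * q ≤ 0)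
    (h2 : 10000 * p + 14143 * q ≤ 0) : (p : ℝ) + q * √2 ≤ 0 := by
  have l1 : 14142 / 10000 ≤ √2 := Real.le_sqrt_of_sq_le (by norm_num)
  have l2 : √2 ≤ 14143 / 10000 := Real.sqrt_le_iff.2 ⟨by norm_num, by norm_num⟩
  have h1' : (10000 : ℝ) * p + 14142 * q ≤ 0 := by exact_mod_cast h1
  have h2' : (10000 : ℝ) * p + 14143 * q ≤ 0 := by exact_mod_cast h2
  rcases le_total (0 : ℝ) q with hq | hq <;> nlinarith

lemma joins_shortDisplacement {x : (ℤ × ℤ) × List (ℕ × ℕ)} (hx : x ∈ shortDisplacements)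
    (p : ℤ × ℤ) : Joins octoGraph p (p + x.1) ((1 + √2) * √(sqNorm x.1 : ℝ)) := by
  obtain ⟨k, hk, h⟩ := reach_shortDisplacements x hx _ (periodClass_lt p)
  refine (joins_of_reach h).mono ?_
  have key : ∀ x ∈ shortDisplacements, ∀ k ∈ x.2,
      10000 * ((k.1 ^ 2 + 2 * k.2 ^ 2 : ℤ) - 3 * sqNorm x.1) +
        14142 * (2 * k.1 * k.2 - 2 * sqNorm x.1) ≤ 0 ∧
      10000 * ((k.1 ^ 2 + 2 * k.2 ^ 2 : ℤ) - 3 * sqNorm x.1) +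
        14143 * (2 * k.1 * k.2 - 2 * sqNorm x.1) ≤ 0 := by
    decide +kernel
  have := add_mul_sqrt_two_nonpos (key x hx k hk).1 (key x hx k hk).2
  push_cast at this
  have h0 : (0 : ℝ) ≤ sqNorm x.1 := by exact_mod_cast sqNorm_nonneg _
  refine abs_le_of_sq_le_sq' ?_ (by positivity) |>.2
  have h2 : √2 ^ 2 = 2 := Real.sq_sqrt (by norm_num)
  rw [mul_pow, Real.sq_sqrt h0]
  linear_combination this + ((k.2 : ℝ) ^ 2 - sqNorm x.1) * h2

lemma joins_shortPeriod {x : (ℤ × ℤ) × (ℤ × ℤ) × List (ℕ × ℕ)} (hx : x ∈ shortPeriods)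
    (p : ℤ × ℤ) : Joins octoGraph p (p + x.1) ((1 + √2) * (x.2.1.1 / x.2.1.2)) := by
  obtain ⟨k, hk, h⟩ := reach_shortPeriods x hx _ (periodClass_lt p)
  refine (joins_of_reach h).mono ?_
  have key : ∀ x ∈ shortPeriods, 0 < x.2.1.2 ∧ ∀ k ∈ x.2.2,
      10000 * ((k.1 : ℤ) * x.2.1.2 - x.2.1.1) + 14142 * (k.2 * x.2.1.2 - x.2.1.1) ≤ 0 ∧
      10000 * ((k.1 : ℤ) * x.2.1.2 - x.2.1.1) + 14143 * (k.2 * x.2.1.2 - x.2.1.1) ≤ 0 := by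
    decide +kernel
  have hm : (0 : ℝ) < x.2.1.2 := by exact_mod_cast (key x hx).1
  have := add_mul_sqrt_two_nonpos ((key x hx).2 k hk).1 ((key x hx).2 k hk).2
  push_cast at this
  rw [mul_div_assoc', le_div_iff₀ hm]
  linarith

/-! ### Reduction of long displacements -/

/-- An integral form of the inequality `|v - e| + n / m ≤ |v|`. -/
def Shortens (e nm v : ℤ × ℤ) : Prop :=
  let l := nm.2 ^ 2 * (2 * (v.1 * e.1 + v.2 * e.2) - sqNorm e) + nm.1 ^ 2
  0 ≤ l ∧ 4 * nm.1 ^ 2 * nm.2 ^ 2 * sqNorm v ≤ l ^ 2 ∧ nm.1 ^ 2 ≤ nm.2 ^ 2 * sqNorm v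

instance (e nm v : ℤ × ℤ) : Decidable (Shortens e nm v) := by
  unfold Shortens
  infer_instance

lemma Shortens.sqrt_add_le {e nm v : ℤ × ℤ} (hn : 0 < nm.1) (hm : 0 < nm.2)
    (h : Shortens e nm v) :
    √(sqNorm (v - e) : ℝ) + nm.1 / nm.2 ≤ √(sqNorm v : ℝ) := by
  obtain ⟨h1, h2, h3⟩ := h
  set l := nm.2 ^ 2 * (2 * (v.1 * e.1 + v.2 * e.2) - sqNorm e) + nm.1 ^ 2 with hl
  have hn' : (0 : ℝ) < nm.1 := by exact_mod_cast hn
  have hm' : (0 : ℝ) < nm.2 := by exact_mod_cast hm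
  have hN : (0 : ℝ) ≤ sqNorm v := by exact_mod_cast sqNorm_nonneg _
  have h1' : (0 : ℝ) ≤ l := by exact_mod_cast h1
  have h2' : 4 * (nm.1 : ℝ) ^ 2 * nm.2 ^ 2 * sqNorm v ≤ (l : ℝ) ^ 2 := by exact_mod_cast h2
  have h3' : (nm.1 : ℝ) ^ 2 ≤ nm.2 ^ 2 * sqNorm v := by exact_mod_cast h3
  have hsub : (nm.2 : ℝ) ^ 2 * sqNorm (v - e) = nm.2 ^ 2 * sqNorm v - l + nm.1 ^ 2 := by
    have : nm.2 ^ 2 * sqNorm (v - e) = nm.2 ^ 2 * sqNorm v - l + nm.1 ^ 2 := by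
      rw [hl]
      simp only [sqNorm, Prod.fst_sub, Prod.snd_sub]
      ring
    exact_mod_cast this
  set r := √(sqNorm v : ℝ) with hr
  have hr2 : r ^ 2 = sqNorm v := Real.sq_sqrt hN
  have hr0 : 0 ≤ r := Real.sqrt_nonneg _
  rw [← hr2] at h2' h3' hsub
  have hlr : 2 * nm.1 * nm.2 * r ≤ l :=
    (abs_le_of_sq_le_sq' (by nlinarith) h1').2
  have hnr : (nm.1 : ℝ) ≤ nm.2 * r := (abs_le_of_sq_le_sq' (by nlinarith) (by positivity)).2
  have hdiv : (nm.1 : ℝ) / nm.2 ≤ r := by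
    rw [div_le_iff₀ hm']
    linarith
  rw [← le_sub_iff_add_le, Real.sqrt_le_left (by linarith),
    ← mul_le_mul_iff_right₀ (pow_pos hm' 2), hsub]
  have : (nm.2 : ℝ) ^ 2 * (r - nm.1 / nm.2) ^ 2 = (nm.2 * r - nm.1) ^ 2 := by
    field_simp
  rw [this]
  nlinarith

/-- In the upper half-plane, every displacement is short or can be shortened by a period. -/
lemma short_or_shortens {v : ℤ × ℤ} (hv : 0 < v.2 ∨ v.2 = 0 ∧ 0 < v.1) :
    (∃ x ∈ shortDisplacements, x.1 = v) ∨
      ∃ x ∈ shortPeriods, Shortens x.1 x.2.1 v ∨ Shortens (-x.1) x.2.1 v := by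
  by_cases hbox : v.1 ∈ Finset.Icc (-40) 40 ∧ v.2 ∈ Finset.Icc 0 40
  · have key : ∀ x ∈ Finset.Icc (-40 : ℤ) 40, ∀ y ∈ Finset.Icc (0 : ℤ) 40,
        0 < y ∨ y = 0 ∧ 0 < x → (∃ w ∈ shortDisplacements, w.1 = (x, y)) ∨
          ∃ w ∈ shortPeriods, Shortens w.1 w.2.1 (x, y) ∨ Shortens (-w.1) w.2.1 (x, y) := by
      decide +kernel
    exact key v.1 hbox.1 v.2 hbox.2 hv
  obtain ⟨x, y⟩ := v
  simp only [Finset.mem_Icc, not_and_or, not_le] at hbox hv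
  right
  rcases le_total (2 * y) (3 * x) with h1 | h1
  · refine ⟨((2, 1), (11, 6), [(3, 1)]), by simp [shortPeriods], .inl ?_⟩
    have hx : 20 ≤ x := by omega
    have hy : 0 ≤ y := by omega
    simp only [Shortens, sqNorm]
    refine ⟨by omega, ?_, by nlinarith⟩
    nlinarith [mul_nonneg hy (sub_nonneg.2 h1), mul_nonneg (sub_nonneg.2 hx) (sub_nonneg.2 hx),
      mul_nonneg hy (sub_nonneg.2 hx)]
  have hy : 0 < y := by omega
  rcases le_total (-y) x with h2 | h2
  · refine ⟨((0, 4), (9, 4), [(4, 1)]), by simp [shortPeriods], .inl ?_⟩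
    have hy : 20 ≤ y := by omega
    simp only [Shortens, sqNorm]
    refine ⟨by omega, ?_, by nlinarith⟩
    nlinarith [mul_nonneg (sub_nonneg.2 h2) (sub_nonneg.2 h1),
      mul_nonneg (sub_nonneg.2 hy) (sub_nonneg.2 hy),
      mul_nonneg (sub_nonneg.2 h2) (sub_nonneg.2 hy)]
  rcases le_total (-(4 * y)) x with h3 | h3
  · refine ⟨((-2, 3), (11, 5), [(3, 1), (1, 3)]), by simp [shortPeriods], .inl ?_⟩
    have hy : 10 ≤ y := by omega
    simp only [Shortens, sqNorm]
    refine ⟨by omega, ?_, by nlinarith⟩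
    nlinarith [mul_nonneg (sub_nonneg.2 h2) (sub_nonneg.2 h3),
      mul_nonneg (sub_nonneg.2 hy) (sub_nonneg.2 hy),
      mul_nonneg (sub_nonneg.2 h2) (sub_nonneg.2 hy)]
  · refine ⟨((4, -2), (24, 7), [(4, 3), (2, 4)]), by simp [shortPeriods], .inr ?_⟩
    have hx : 20 ≤ -x := by omega
    simp only [Shortens, sqNorm, Prod.fst_neg, Prod.snd_neg, neg_neg]
    refine ⟨by omega, ?_, by nlinarith⟩
    nlinarith [mul_nonneg hy.le (sub_nonneg.2 h3),
      mul_nonneg (sub_nonneg.2 hx) (sub_nonneg.2 hx),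
      mul_nonneg hy.le (sub_nonneg.2 hx)]

lemma joins_of_shortens {x : (ℤ × ℤ) × (ℤ × ℤ) × List (ℕ × ℕ)} (hx : x ∈ shortPeriods)
    {e v : ℤ × ℤ} (he : e = x.1 ∨ e = -x.1) (h : Shortens e x.2.1 v)
    (ih : ∀ w, sqNorm w < sqNorm v → ∀ p,
      Joins octoGraph p (p + w) ((1 + √2) * √(sqNorm w : ℝ))) (p : ℤ × ℤ) :
    Joins octoGraph p (p + v) ((1 + √2) * √(sqNorm v : ℝ)) := by
  have hpos : ∀ x ∈ shortPeriods, 0 < x.2.1.1 ∧ 0 < x.2.1.2 := by decide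
  obtain ⟨hn, hm⟩ := hpos x hx
  have hle := h.sqrt_add_le hn hm
  have hlt : sqNorm (v - e) < sqNorm v := by
    have hk : (0 : ℝ) < x.2.1.1 / x.2.1.2 := by
      have : (0 : ℝ) < x.2.1.1 := by exact_mod_cast hn
      have : (0 : ℝ) < x.2.1.2 := by exact_mod_cast hm
      positivity
    have := (Real.sqrt_lt_sqrt_iff (by exact_mod_cast sqNorm_nonneg (v - e))).1
      (by linarith : √(sqNorm (v - e) : ℝ) < √(sqNorm v : ℝ))
    exact_mod_cast this
  have hperiod : Joins octoGraph p (p + e) ((1 + √2) * (x.2.1.1 / x.2.1.2)) := by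
    rcases he with rfl | rfl
    · exact joins_shortPeriod hx p
    · have := (joins_shortPeriod hx (p + -x.1)).symm
      rwa [neg_add_cancel_right] at this
  have := hperiod.trans (ih (v - e) hlt (p + e))
  rw [add_assoc, add_sub_cancel, ← mul_add] at this
  exact this.mono (by gcongr; linarith)

lemma joins_octoGraph (p v : ℤ × ℤ) :
    Joins octoGraph p (p + v) ((1 + √2) * √(sqNorm v : ℝ)) := by
  induction hN : (sqNorm v).toNat using Nat.strong_induction_on generalizing p v with
  | _ N ih =>
  replace ih : ∀ w, sqNorm w < sqNorm v → ∀ p,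
      Joins octoGraph p (p + w) ((1 + √2) * √(sqNorm w : ℝ)) := fun w hw p =>
    ih _ (by have := sqNorm_nonneg w; omega) p w rfl
  have upper : ∀ w : ℤ × ℤ, sqNorm w = sqNorm v → (0 < w.2 ∨ w.2 = 0 ∧ 0 < w.1) → ∀ p,
      Joins octoGraph p (p + w) ((1 + √2) * √(sqNorm w : ℝ)) := by
    intro w hw hpos p
    rcases short_or_shortens hpos with ⟨x, hx, rfl⟩ | ⟨x, hx, h | h⟩
    · exact joins_shortDisplacement hx p
    · exact joins_of_shortens hx (.inl rfl) h (hw ▸ ih) p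
    · exact joins_of_shortens hx (.inr rfl) h (hw ▸ ih) p
  by_cases h0 : v = 0
  · subst h0
    rw [add_zero]
    exact (joins_refl p).mono (by positivity)
  by_cases hv : 0 < v.2 ∨ v.2 = 0 ∧ 0 < v.1
  · exact upper v rfl hv p
  · have hne : v.1 ≠ 0 ∨ v.2 ≠ 0 := by
      by_contra! h
      exact h0 (Prod.ext h.1 h.2)
    have := (upper (-v) (sqNorm_neg v)
      (by simp only [Prod.fst_neg, Prod.snd_neg]; omega) (p + v)).symm
    rwa [add_neg_cancel_right, sqNorm_neg] at this

/-- The degree-3 dilation of ℤ² equals 1+√2, and the infimum is attained. -/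
theorem degree_three_dilation_of_square_lattice :
    IsLeast {d : ℝ≥0∞ | ∃ G : SimpleGraph (ℤ × ℤ), IsPlane G ∧ MaxDegThree G ∧ dil G = d}
      (ENNReal.ofReal (1 + Real.sqrt 2)) := by
  constructor
  · exact ⟨octoGraph, isPlane_octoGraph, maxDegThree_octoGraph, le_antisymm
      (dil_le_of_joins (by positivity) fun p v _ => joins_octoGraph p v)
      maxDegThree_octoGraph.le_dil⟩
  · rintro _ ⟨G, -, hG, rfl⟩
    exact hG.le_dil
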